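/- arXiv:1407.1480 — 11 statements merged into one kernel-verified Lean document; each statement's English description precedes it below -/
import Mathlib

section
/- The graph J_I has a proper colouring that respects the list assignment L if and only if the instance I has a truth assignment in which each clause contains at least one true and at least one false variable. -/
open SimpleGraph

/-- An instance of Not-All-Equal 3-Satisfiability with positive literals:
variables are indexed by `Fin n`, and each of the `m` clauses is an ordered
triple of variables. -/
structure NAE (n m : ℕ) where
  clause : Fin m → Fin 3 → Fin n

/-- A truth assignment in which each clause contains at least one true and at
least one false variable. -/
def NAE.Satisfiable {n m : ℕ} (I : NAE n m) : Prop :=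
  ∃ τ : Fin n → Bool, ∀ j : Fin m,
    (∃ h : Fin 3, τ (I.clause j h) = true) ∧ (∃ h : Fin 3, τ (I.clause j h) = false)

/-- Vertices of the graph `J_I`: `a`- and `b`-type vertices of the two clause
components (`p = false` for the unprimed component, `p = true` for the primed
one), and one `x`-type vertex per variable.  The `a`-vertices of a component are
`a j p 0, a j p 1, a j p 2` and its `b`-vertices `b j p 0, b j p 1`; the
component is the induced path `a j p 0 - b j p 0 - a j p 1 - b j p 1 - a j p 2`. -/
inductive JV (n m : ℕ) where
  | a (j : Fin m) (p : Bool) (h : Fin 3)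
  | b (j : Fin m) (p : Bool) (h : Fin 2)
  | x (i : Fin n)

/-- Base relation for the edges of `J_I`. -/
def JRel {n m : ℕ} (I : NAE n m) : JV n m → JV n m → Prop
  | .a j p h, .b j' p' h' => j = j' ∧ p = p' ∧ (h = h'.castSucc ∨ h = h'.succ)
  | .a j _ h, .x i => I.clause j h = i
  | .x _, .b _ _ _ => True
  | _, _ => False

/-- The graph `J_I`. -/
def JGraph {n m : ℕ} (I : NAE n m) : SimpleGraph (JV n m) := fromRel (JRel I)

/-- The 4-list assignment `L` of `J_I`. -/
def Lassign {n m : ℕ} : JV n m → Finset ℕ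
  | .a _ p h =>
      if p then (if h.val = 0 then {1,4} else if h.val = 1 then {1,3,4} else {1,3})
      else (if h.val = 0 then {2,4} else if h.val = 1 then {2,3,4} else {2,3})
  | .b _ _ _ => {3,4}
  | .x _ => {1,2}

/-- Vertices of the graph `J_I'`: those of `J_I` together with the `c`-type
subdivision vertices, one for each edge between an `a`-type and an `x`-type
vertex (i.e., one for each `a`-type vertex `a j p h`, subdividing its edge to
the vertex of the variable `clause j h`). -/
inductive JV' (n m : ℕ) where
  | a (j : Fin m) (p : Bool) (h : Fin 3)
  | b (j : Fin m) (p : Bool) (h : Fin 2)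
  | x (i : Fin n)
  | c (j : Fin m) (p : Bool) (h : Fin 3)

/-- Base relation for the edges of `J_I'`. -/
def J'Rel {n m : ℕ} (I : NAE n m) : JV' n m → JV' n m → Prop
  | .a j p h, .b j' p' h' => j = j' ∧ p = p' ∧ (h = h'.castSucc ∨ h = h'.succ)
  | .c j p h, .a j' p' h' => j = j' ∧ p = p' ∧ h = h'
  | .c j _ h, .x i => I.clause j h = i
  | .x _, .b _ _ _ => True
  | _, _ => False

/-- The graph `J_I'`. -/
def J'Graph {n m : ℕ} (I : NAE n m) : SimpleGraph (JV' n m) := fromRel (J'Rel I)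

/-- The 4-list assignment `L'` of `J_I'`. -/
def L'assign {n m : ℕ} : JV' n m → Finset ℕ
  | .a _ p h =>
      if p then (if h.val = 0 then {1,4} else if h.val = 1 then {1,3,4} else {1,3})
      else (if h.val = 0 then {2,4} else if h.val = 1 then {2,3,4} else {2,3})
  | .b _ _ _ => {3,4}
  | .x _ => {1,2}
  | .c _ _ _ => {1,2}

/-- `a`-type or `x`-type vertices of `J_I'`. -/
def JV'.isAX {n m : ℕ} : JV' n m → Bool
  | .a _ _ _ => true
  | .x _ => true
  | _ => false

/-- `b`-type vertices of `J_I'`. -/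
def JV'.isB {n m : ℕ} : JV' n m → Bool
  | .b _ _ _ => true
  | _ => false

/-- `c`-type vertices of `J_I'`. -/
def JV'.isC {n m : ℕ} : JV' n m → Bool
  | .c _ _ _ => true
  | _ => false

/-- Vertices of the graph `J_I^k`: the vertices of `J_I'` together with, for
each vertex `v` of `J_I'`, exactly `k - |L'(v)|` pendant vertices. -/
inductive JVK (n m k : ℕ) where
  | orig (v : JV' n m)
  | pend (v : JV' n m) (i : Fin (k - (L'assign v).card))

/-- Base relation for the edges of `J_I^k`. -/
def JKRel {n m k : ℕ} (I : NAE n m) : JVK n m k → JVK n m k → Prop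
  | .orig u, .orig v => J'Rel I u v
  | .pend v _, .orig u => u = v
  | _, _ => False

/-- The graph `J_I^k`. -/
def JKGraph {n m : ℕ} (I : NAE n m) (k : ℕ) : SimpleGraph (JVK n m k) :=
  fromRel (JKRel I)

/-- A graph is chordal bipartite if it is bipartite (2-colourable) and has no
induced cycle on any number of vertices other than four. -/
def ChordalBipartite {V : Type*} (G : SimpleGraph V) : Prop :=
  G.Colorable 2 ∧ ∀ s : ℕ, 3 ≤ s → s ≠ 4 → IsEmpty (cycleGraph s ↪g G)

/-- The disjoint union `P_1 + 2P_2` on five vertices: vertex `0` is isolated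
and `1-2`, `3-4` are the two `P_2`s. -/
def P1plus2P2 : SimpleGraph (Fin 5) :=
  fromRel (fun u v => (u = 1 ∧ v = 2) ∨ (u = 3 ∧ v = 4))

/-- The disjoint union `P_1 + P_4` on five vertices: vertex `0` is isolated and
`1-2-3-4` is the `P_4`. -/
def P1plusP4 : SimpleGraph (Fin 5) :=
  fromRel (fun u v => (u = 1 ∧ v = 2) ∨ (u = 2 ∧ v = 3) ∨ (u = 3 ∧ v = 4))

/-- The vertex of `Fin 23` carrying label `i ∈ {1, …, 23}`. -/
def vtx (i : ℕ) : Fin 23 := ⟨(i - 1) % 23, by omega⟩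

/-- The edges (by labels in `{1, …, 23}`) of the graph `M'`, i.e. of the
Mycielski graph `M_5` minus the edge `{17, 23}`. -/
def MpEdges : List (ℕ × ℕ) :=
  [(1,2),(2,3),(3,5),(5,4),(4,1),
   (6,2),(6,4),(7,1),(7,3),(8,2),(8,5),(9,1),(9,5),(10,3),(10,4),
   (11,6),(11,7),(11,8),(11,9),(11,10),
   (12,2),(12,4),(12,7),(12,9),(13,1),(13,3),(13,6),(13,8),
   (14,2),(14,5),(14,7),(14,10),(15,1),(15,5),(15,6),(15,10),
   (16,3),(16,4),(16,8),(16,9),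
   (17,2),(17,4),(17,11),(18,1),(18,3),(18,11),(19,2),(19,5),(19,11),
   (20,1),(20,5),(20,11),(21,3),(21,4),(21,11),
   (22,6),(22,7),(22,8),(22,9),(22,10),
   (12,23),(13,23),(14,23),(15,23),(16,23),(18,23),(19,23),(20,23),(21,23),(22,23)]

/-- The edges (by labels) of the Mycielski graph `M_5`. -/
def M5Edges : List (ℕ × ℕ) := (17,23) :: MpEdges

/-- The Mycielski graph `M_5` on 23 vertices. -/
def M5 : SimpleGraph (Fin 23) :=
  fromRel (fun u v => ∃ e ∈ M5Edges, u = vtx e.1 ∧ v = vtx e.2)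

/-- The graph `M'`, i.e. `M_5` minus the edge `{17, 23}`. -/
def Mp : SimpleGraph (Fin 23) :=
  fromRel (fun u v => ∃ e ∈ MpEdges, u = vtx e.1 ∧ v = vtx e.2)

/-- The vertex set `T = {2, 4, 11, 23}` of `M'`. -/
def Tset : Set (Fin 23) := {vtx 2, vtx 4, vtx 11, vtx 23}

/-- The list of colours `{1,2,3,4} \ L'(v)`, used to precolour the pendant
vertices attached to `v` in `J_I^4`. -/
def complList {n m : ℕ} : JV' n m → List ℕ
  | .a _ p h =>
      if p then (if h.val = 0 then [2,3] else if h.val = 1 then [2] else [2,4])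
      else (if h.val = 0 then [1,3] else if h.val = 1 then [1] else [1,4])
  | .b _ _ _ => [1,2]
  | .x _ => [3,4]
  | .c _ _ _ => [3,4]

/-- The precolouring `c_{W^4}` of the pendant vertices of `J_I^4`: the pendant
vertices attached to `v` receive the distinct colours of `{1,2,3,4} \ L'(v)`. -/
def cW4 {n m : ℕ} (v : JV' n m) (i : Fin (4 - (L'assign v).card)) : ℕ :=
  (complList v).getD i.val 0

/-- The vertex `t_j` of (the copy of) `M'`, for `j ∈ {1,2,3,4}`:
`t_1 = 2`, `t_2 = 4`, `t_3 = 11`, `t_4 = 23`. -/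
def tvert (j : ℕ) : Fin 23 :=
  if j = 1 then vtx 2 else if j = 2 then vtx 4 else if j = 3 then vtx 11 else vtx 23

/-- Vertices of the graph `J*_I`: the vertices of `J_I'`, the pendant vertices
of `J_I^4` attached to `a`- or `x`-type vertices (the vertices pendant to
`B ∪ C` having been removed), and a copy of `M'`. -/
inductive JStarV (n m : ℕ) where
  | orig (v : JV' n m)
  | pend (v : JV' n m) (i : Fin (4 - (L'assign v).card)) (hv : v.isAX = true)
  | mv (t : Fin 23)

/-- Base relation for the edges of `J*_I`. -/
def JStarRel {n m : ℕ} (I : NAE n m) : JStarV n m → JStarV n m → Prop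
  | .orig u, .orig v => J'Rel I u v
  | .pend v _ _, .orig u => u = v
  | .pend v i _, .mv t => ∃ j ∈ ({1,2,3,4} : Finset ℕ), j ≠ cW4 v i ∧ t = tvert j
  | .orig u, .mv t =>
      (u.isB = true ∧ (t = vtx 2 ∨ t = vtx 4)) ∨
      (u.isC = true ∧ (t = vtx 11 ∨ t = vtx 23))
  | .mv s, .mv t => ∃ e ∈ MpEdges, s = vtx e.1 ∧ t = vtx e.2
  | _, _ => False

/-- The graph `J*_I`. -/
def JStar {n m : ℕ} (I : NAE n m) : SimpleGraph (JStarV n m) := fromRel (JStarRel I)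

/-- `b`-type vertices of `J_I^k`. -/
def JVK.isB {n m k : ℕ} : JVK n m k → Bool
  | .orig v => v.isB
  | _ => false

/-- A pendant vertex of `J_I^4 - B`: a vertex with exactly one neighbour among
the non-`b`-type vertices. -/
def PendantOutsideB {n m : ℕ} (I : NAE n m) (v : JVK n m 4) : Prop :=
  ∃! w : JVK n m 4, w.isB = false ∧ (JKGraph I 4).Adj v w


/-- The colour other than `3` and `4` in the lists of the `a`-vertices of a component. -/
def componentColour (p : Bool) : ℕ := if p then 1 else 2

/-- The colouring of `J_I` induced by a truth assignment: the first `a`-vertex of a component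
whose variable does not carry the component's own colour receives that colour. -/
def NAE.colouring {n m : ℕ} (I : NAE n m) (τ : Fin n → Bool) : JV n m → ℕ
  | .a j p h =>
      if h = 0 then (if τ (I.clause j 0) ≠ p then componentColour p else 4)
      else if τ (I.clause j 0) ≠ p then 3
      else if h = 1 then (if τ (I.clause j 1) ≠ p then componentColour p else 4)
      else if τ (I.clause j 1) ≠ p then 3 else componentColour p
  | .b j p h =>
      if τ (I.clause j 0) ≠ p ∨ (h = 1 ∧ τ (I.clause j 1) ≠ p) then 4 else 3
  | .x i => componentColour (τ i)

theorem NAE.colouring_mem {n m : ℕ} (I : NAE n m) (τ : Fin n → Bool) (u : JV n m) :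
    I.colouring τ u ∈ Lassign u := by
  rcases u with ⟨j, p, h⟩ | ⟨j, p, h⟩ | i
  · fin_cases h <;> cases p <;> cases h₀ : τ (I.clause j 0) <;>
      cases h₁ : τ (I.clause j 1) <;> simp [NAE.colouring, Lassign, componentColour, h₀, h₁]
  · simp only [NAE.colouring, Lassign]
    split_ifs <;> simp
  · cases h : τ i <;> simp [NAE.colouring, Lassign, componentColour, h]

theorem NAE.colouring_ne_of_rel {n m : ℕ} (I : NAE n m) (τ : Fin n → Bool)
    (hτ : ∀ j p, ∃ h, τ (I.clause j h) ≠ p) {u v : JV n m} (huv : JRel I u v) :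
    I.colouring τ u ≠ I.colouring τ v := by
  rcases u with ⟨j, p, h⟩ | ⟨j, p, h⟩ | i <;> rcases v with ⟨j', p', h'⟩ | ⟨j', p', h'⟩ | i' <;>
    simp only [JRel] at huv
  · obtain ⟨rfl, rfl, huv⟩ := huv
    fin_cases h <;> fin_cases h' <;> simp at huv <;> cases p <;>
      cases h₀ : τ (I.clause j 0) <;> cases h₁ : τ (I.clause j 1) <;>
      simp [NAE.colouring, componentColour, h₀, h₁]
  · subst huv
    have := hτ j p
    rw [Fin.exists_fin_succ, Fin.exists_fin_two] at this
    fin_cases h <;> cases p <;> cases h₀ : τ (I.clause j 0) <;>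
      cases h₁ : τ (I.clause j 1) <;> cases h₂ : τ (I.clause j 2) <;>
      simp [NAE.colouring, componentColour, h₀, h₁, h₂] at this ⊢
  · simp only [NAE.colouring, componentColour]
    split_ifs <;> simp

/-- In a colouring respecting the lists, the variables of a clause cannot all carry the
colour shared with one of its components. -/
theorem exists_colour_ne_componentColour {n m : ℕ} (I : NAE n m) {c : JV n m → ℕ}
    (hc : ∀ u v, (JGraph I).Adj u v → c u ≠ c v) (hL : ∀ u, c u ∈ Lassign u)
    (j : Fin m) (p : Bool) : ∃ h, c (.x (I.clause j h)) ≠ componentColour p := by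
  by_contra! H
  have hab : ∀ (h : Fin 3) (h' : Fin 2), h = h'.castSucc ∨ h = h'.succ →
      c (.a j p h) ≠ c (.b j p h') := fun h h' hh =>
    hc _ _ (by simp [JGraph, JRel, hh])
  have hax : ∀ h, c (.a j p h) ≠ componentColour p := fun h =>
    H h ▸ hc _ _ (by simp [JGraph, JRel])
  have h₀₀ := hab 0 0 (by decide)
  have h₁₀ := hab 1 0 (by decide)
  have h₁₁ := hab 1 1 (by decide)
  have h₂₁ := hab 2 1 (by decide)
  have a₀ := hL (.a j p 0)
  have a₁ := hL (.a j p 1)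
  have a₂ := hL (.a j p 2)
  have b₀ := hL (.b j p 0)
  have b₁ := hL (.b j p 1)
  have x₀ := hax 0
  have x₁ := hax 1
  have x₂ := hax 2
  cases p <;> simp [Lassign, componentColour] at * <;> omega

/- Statement 0 -/
theorem stmt0 {n m : ℕ} (I : NAE n m) :
    (∃ c : JV n m → ℕ, (∀ u v, (JGraph I).Adj u v → c u ≠ c v) ∧ ∀ u, c u ∈ Lassign u) ↔
      I.Satisfiable := by
  constructor
  · rintro ⟨c, hc, hL⟩
    refine ⟨fun i => decide (c (.x i) = 1), fun j => ⟨?_, ?_⟩⟩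
    · obtain ⟨h, hh⟩ := exists_colour_ne_componentColour I hc hL j false
      have hx := hL (.x (I.clause j h))
      simp only [Lassign, Finset.mem_insert, Finset.mem_singleton] at hx
      exact ⟨h, decide_eq_true (hx.resolve_right hh)⟩
    · obtain ⟨h, hh⟩ := exists_colour_ne_componentColour I hc hL j true
      exact ⟨h, decide_eq_false hh⟩
  · rintro ⟨τ, hτ⟩
    have hτ' : ∀ j p, ∃ h, τ (I.clause j h) ≠ p := by
      rintro j (_ | _)
      · simpa using (hτ j).1
      · simpa using (hτ j).2
    refine ⟨I.colouring τ, fun u v huv => ?_, I.colouring_mem τ⟩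
    rcases ((fromRel_adj _ _ _).1 huv).2 with h | h
    · exact I.colouring_ne_of_rel τ hτ' h
    · exact (I.colouring_ne_of_rel τ hτ' h).symm
end

section
/- The graph J_I is P_6-free, that is, J_I contains no induced subgraph isomorphic to the path on 6 vertices. -/
open SimpleGraph

namespace JV

variable {n m : ℕ}

/-- The type of a vertex of `J_I`: `0` for `a`-type, `1` for `b`-type, `2` for `x`-type. -/
def kind : JV n m → Fin 3
  | .a _ _ _ => 0
  | .b _ _ _ => 1
  | .x _ => 2

/-- The clause component containing a non-`x`-type vertex. -/
def component : JV n m → Option (Fin m × Bool)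
  | .a j p _ => some (j, p)
  | .b j p _ => some (j, p)
  | .x _ => none

variable {I : NAE n m} {u v w : JV n m}

lemma kind_ne_of_adj (h : (JGraph I).Adj u v) : u.kind ≠ v.kind := by
  cases u <;> cases v <;> simp_all [JGraph, JRel, kind]

lemma adj_of_kind_x_b (hu : u.kind = 2) (hv : v.kind = 1) : (JGraph I).Adj u v := by
  cases u <;> cases v <;> simp_all [JGraph, JRel, kind]

lemma eq_of_adj_kind_a_x (hv : v.kind = 0) (hu : u.kind = 2) (hw : w.kind = 2)
    (huv : (JGraph I).Adj u v) (hvw : (JGraph I).Adj v w) : u = w := by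
  cases u <;> cases v <;> cases w <;> simp_all [JGraph, JRel, kind]

lemma component_eq_of_adj (hu : u.kind ≠ 2) (hv : v.kind ≠ 2) (h : (JGraph I).Adj u v) :
    u.component = v.component := by
  cases u <;> cases v <;> simp_all [JGraph, JRel, kind, component]

lemma eq_or_eq_or_eq_of_kind_b (hu : u.kind = 1) (hv : v.kind = 1) (hw : w.kind = 1)
    (huv : u.component = v.component) (hvw : v.component = w.component) :
    u = v ∨ v = w ∨ u = w := by
  cases u <;> cases v <;> cases w <;> simp_all [kind, component]
  omega

end JV

set_option maxRecDepth 10000 in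
/-- A sequence of six types in which consecutive types differ, the types `2` and `1` occur only
next to each other, and `2, 0, 2` does not occur, alternates between `0` and `1`. -/
lemma alternates_of_forall (k : Fin 6 → Fin 3)
    (hne : ∀ i j : Fin 6, i.val + 1 = j.val → k i ≠ k j)
    (hadj : ∀ i j : Fin 6, k i = 2 → k j = 1 → i.val + 1 = j.val ∨ j.val + 1 = i.val)
    (hxax : ∀ i j l : Fin 6, i.val + 1 = j.val → j.val + 1 = l.val →
      ¬ (k i = 2 ∧ k j = 0 ∧ k l = 2)) :
    (∀ i, k i ≠ 2) ∧ ((k 0 = 1 ∧ k 2 = 1 ∧ k 4 = 1) ∨ (k 1 = 1 ∧ k 3 = 1 ∧ k 5 = 1)) := by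
  revert k
  decide

/- Statement 1 -/
theorem stmt1 {n m : ℕ} (I : NAE n m) : IsEmpty (pathGraph 6 ↪g JGraph I) := by
  refine ⟨fun e => ?_⟩
  have hadj (i j : Fin 6) :
      (JGraph I).Adj (e i) (e j) ↔ i.val + 1 = j.val ∨ j.val + 1 = i.val := by
    rw [e.map_adj_iff, pathGraph_adj]
  obtain ⟨hx, hb⟩ := alternates_of_forall (fun i => (e i).kind)
    (fun i j h => JV.kind_ne_of_adj ((hadj i j).2 (.inl h)))
    (fun i j hi hj => (hadj i j).1 (JV.adj_of_kind_x_b hi hj))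
    (fun i j l hij hjl ⟨hi, hj, hl⟩ => by
      have := e.injective (JV.eq_of_adj_kind_a_x hj hi hl
        ((hadj i j).2 (.inl hij)) ((hadj j l).2 (.inl hjl)))
      omega)
  have hcomp (i j : Fin 6) (h : i.val + 1 = j.val) : (e i).component = (e j).component :=
    JV.component_eq_of_adj (hx i) (hx j) ((hadj i j).2 (.inl h))
  rcases hb with ⟨h₁, h₂, h₃⟩ | ⟨h₁, h₂, h₃⟩
  · have := JV.eq_or_eq_or_eq_of_kind_b h₁ h₂ h₃
      ((hcomp 0 1 rfl).trans (hcomp 1 2 rfl)) ((hcomp 2 3 rfl).trans (hcomp 3 4 rfl))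
    simp [e.injective.eq_iff] at this
  · have := JV.eq_or_eq_or_eq_of_kind_b h₁ h₂ h₃
      ((hcomp 1 2 rfl).trans (hcomp 2 3 rfl)) ((hcomp 3 4 rfl).trans (hcomp 4 5 rfl))
    simp [e.injective.eq_iff] at this
end

section
/- The graph J_I' is P_8-free, that is, J_I' contains no induced subgraph isomorphic to the path on 8 vertices. -/
open SimpleGraph

/-- The type of a vertex of `J_I'`, coded so that adjacent vertices have cyclically
consecutive types: `a`, `b`, `x`, `c` are `0`, `1`, `2`, `3`. -/
def JV'.kind {n m : ℕ} : JV' n m → Fin 4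
  | .a _ _ _ => 0
  | .b _ _ _ => 1
  | .x _ => 2
  | .c _ _ _ => 3

section

variable {n m : ℕ} {I : NAE n m} {u v w y z : JV' n m}

theorem J'Graph_kind_of_adj (h : (J'Graph I).Adj u v) :
    v.kind = u.kind + 1 ∨ u.kind = v.kind + 1 := by
  cases u <;> cases v <;> simp_all [J'Graph, J'Rel, JV'.kind]

theorem J'Graph_adj_of_kind (hu : u.kind = 2) (hv : v.kind = 1) : (J'Graph I).Adj u v := by
  cases u <;> cases v <;> simp_all [J'Graph, J'Rel, JV'.kind]

/-- An `a`-type vertex has at most one `c`-type neighbour. -/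
theorem J'Graph_eq_of_kind_c_a_c (huv : (J'Graph I).Adj u v) (hvw : (J'Graph I).Adj v w)
    (hu : u.kind = 3) (hv : v.kind = 0) (hw : w.kind = 3) : u = w := by
  cases u <;> cases v <;> cases w <;> simp_all [J'Graph, J'Rel, JV'.kind]

/-- A `c`-type vertex has at most one `a`-type neighbour. -/
theorem J'Graph_eq_of_kind_a_c_a (huv : (J'Graph I).Adj u v) (hvw : (J'Graph I).Adj v w)
    (hu : u.kind = 0) (hv : v.kind = 3) (hw : w.kind = 0) : u = w := by
  cases u <;> cases v <;> cases w <;> simp_all [J'Graph, J'Rel, JV'.kind]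

/-- A `c`-type vertex has at most one `x`-type neighbour. -/
theorem J'Graph_eq_of_kind_x_c_x (huv : (J'Graph I).Adj u v) (hvw : (J'Graph I).Adj v w)
    (hu : u.kind = 2) (hv : v.kind = 3) (hw : w.kind = 2) : u = w := by
  cases u <;> cases v <;> cases w <;> simp_all [J'Graph, J'Rel, JV'.kind]

/-- A clause component has only two `b`-type vertices. -/
theorem J'Graph_eq_of_kind_b_a_b_a_b (huv : (J'Graph I).Adj u v) (hvw : (J'Graph I).Adj v w)
    (hwy : (J'Graph I).Adj w y) (hyz : (J'Graph I).Adj y z)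
    (hu : u.kind = 1) (hv : v.kind = 0) (hw : w.kind = 1) (hy : y.kind = 0) (hz : z.kind = 1) :
    u = w ∨ w = z ∨ u = z := by
  cases u <;> simp only [JV'.kind, Fin.reduceEq] at hu
  cases v <;> simp only [JV'.kind, Fin.reduceEq] at hv
  cases w <;> simp only [JV'.kind, Fin.reduceEq] at hw
  cases y <;> simp only [JV'.kind, Fin.reduceEq] at hy
  cases z <;> simp only [JV'.kind, Fin.reduceEq] at hz
  simp only [J'Graph, J'Rel, fromRel_adj] at huv hvw hwy hyz
  simp only [JV'.b.injEq]
  grind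

end

/-- No word of length eight satisfies the restrictions that the vertex types along an induced
path of `J_I'` obey. -/
theorem not_exists_kind_word (k : Fin 8 → Fin 4)
    (hadj : ∀ i : Fin 7, k i.succ = k i.castSucc + 1 ∨ k i.castSucc = k i.succ + 1)
    (hxb : ∀ i j : Fin 8, k i = 2 → k j = 1 → i.val + 1 = j.val ∨ j.val + 1 = i.val)
    (hthree : ∀ i : Fin 6, ∀ p ∈ [((3 : Fin 4), (0 : Fin 4)), (0, 3), (2, 3)],
      ¬ (k (i.castLE (by omega)) = p.1 ∧ k (i.succ.castLE (by omega)) = p.2 ∧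
        k i.succ.succ = p.1))
    (hfive : ∀ i : Fin 4, ¬ (k (i.castLE (by omega)) = 1 ∧ k (i.succ.castLE (by omega)) = 0 ∧
      k (i.succ.succ.castLE (by omega)) = 1 ∧ k (i.succ.succ.succ.castLE (by omega)) = 0 ∧
      k i.succ.succ.succ.succ = 1)) : False := by
  simp [Fin.forall_fin_succ] at hadj hxb hthree hfive
  grind (splits := 40)

/- Statement 3 -/
theorem stmt3 {n m : ℕ} (I : NAE n m) : IsEmpty (pathGraph 8 ↪g J'Graph I) := by
  refine ⟨fun f => ?_⟩
  have hstep (i j : Fin 8) (h : i.val + 1 = j.val) : (J'Graph I).Adj (f i) (f j) :=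
    f.map_adj_iff.2 (pathGraph_adj.2 (Or.inl h))
  have hne (i j : Fin 8) (h : i ≠ j) : f i ≠ f j := f.injective.ne h
  refine not_exists_kind_word (fun i => (f i).kind) ?_ ?_ ?_ ?_
  · exact fun i => J'Graph_kind_of_adj (hstep _ _ (by simp))
  · exact fun i j hi hj => pathGraph_adj.1 (f.map_adj_iff.1 (J'Graph_adj_of_kind hi hj))
  · rintro i p hp ⟨h₁, h₂, h₃⟩
    have h₁₂ := hstep (i.castLE (by omega)) (i.succ.castLE (by omega)) (by simp)
    have h₂₃ := hstep (i.succ.castLE (by omega)) i.succ.succ (by simp)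
    refine hne (i.castLE (by omega)) i.succ.succ (by simp [Fin.ext_iff]; omega) ?_
    simp only [List.mem_cons, List.not_mem_nil, or_false] at hp
    rcases hp with rfl | rfl | rfl
    · exact J'Graph_eq_of_kind_c_a_c h₁₂ h₂₃ h₁ h₂ h₃
    · exact J'Graph_eq_of_kind_a_c_a h₁₂ h₂₃ h₁ h₂ h₃
    · exact J'Graph_eq_of_kind_x_c_x h₁₂ h₂₃ h₁ h₂ h₃
  · rintro i ⟨h₁, h₂, h₃, h₄, h₅⟩
    rcases J'Graph_eq_of_kind_b_a_b_a_b (hstep _ _ (by simp)) (hstep _ _ (by simp))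
      (hstep _ _ (by simp)) (hstep _ _ (by simp)) h₁ h₂ h₃ h₄ h₅ with h | h | h <;>
    exact hne _ _ (by simp [Fin.ext_iff] <;> omega) h
end

section
/- The graph J_I' is chordal bipartite, that is, J_I' is bipartite and every induced cycle of J_I' has exactly four vertices. -/
open SimpleGraph

/-- `J_I'` is bipartite: its `a`- and `x`-type vertices form one class, its `b`- and `c`-type vertices
the other. -/
lemma J'Graph_colorable_two {n m : ℕ} (I : NAE n m) : (J'Graph I).Colorable 2 := by
  refine ⟨Coloring.mk (fun v => if v.isAX then (0 : Fin 2) else 1) ?_⟩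
  rintro (_ | _ | _ | _) (_ | _ | _ | _) h <;>
    simp_all [J'Graph, J'Rel, JV'.isAX]

/-- In a bi-infinite walk in `J_I'` that never turns back and never has adjacent vertices at
distance three, a `c`-type vertex is not followed by an `a`-type vertex. -/
lemma J'Graph_walk_not_c_a {n m : ℕ} (I : NAE n m) (g : ℤ → JV' n m)
    (h1 : ∀ i, (J'Graph I).Adj (g i) (g (i + 1)))
    (h2 : ∀ i, g i ≠ g (i + 2))
    (h3 : ∀ i, ¬ (J'Graph I).Adj (g i) (g (i + 3)))
    (i : ℤ) {j : Fin m} {p : Bool} {h : Fin 3} (hc : g (i + 1) = .c j p h)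
    {j' : Fin m} {p' : Bool} {h' : Fin 3} (ha : g (i + 2) = .a j' p' h') : False := by
  have e1 := h1 i
  have e2 := h1 (i + 1)
  have e3 := h1 (i + 2)
  have d1 := h2 i
  have d2 := h2 (i + 1)
  have t := h3 i
  rw [show i + 1 + 1 = i + 2 by ring] at e2
  rw [show i + 2 + 1 = i + 3 by ring] at e3
  rw [show i + 1 + 2 = i + 3 by ring] at d2
  rw [hc] at e1 e2 d2
  rw [ha] at e2 e3 d1
  clear h1 h2 h3 hc ha
  rcases hg : g i with _ | _ | _ | _ <;> rcases hg3 : g (i + 3) with _ | _ | _ | _ <;>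
    simp_all [J'Graph, J'Rel]

/-- A walk as in `J'Graph_walk_not_c_a` contains no `c`-type vertex. -/
lemma J'Graph_walk_not_c {n m : ℕ} (I : NAE n m) (g : ℤ → JV' n m)
    (h1 : ∀ i, (J'Graph I).Adj (g i) (g (i + 1)))
    (h2 : ∀ i, g i ≠ g (i + 2))
    (h3 : ∀ i, ¬ (J'Graph I).Adj (g i) (g (i + 3)))
    (i : ℤ) (j : Fin m) (p : Bool) (h : Fin 3) : g i ≠ .c j p h := by
  intro hc
  have next_not_a : ∀ j' p' h', g (i + 1) ≠ .a j' p' h' := fun j' p' h' ha =>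
    J'Graph_walk_not_c_a I g h1 h2 h3 (i - 1) (by rw [← hc]; congr 1; ring)
      (by rw [← ha]; congr 1; ring)
  have prev_not_a : ∀ j' p' h', g (i - 1) ≠ .a j' p' h' := fun j' p' h' ha =>
    J'Graph_walk_not_c_a I (fun k => g (-k))
      (fun k => by
        have := (h1 (-k - 1)).symm
        rw [show -k - 1 + 1 = -k by ring] at this
        rwa [show -(k + 1) = -k - 1 by ring])
      (fun k => by
        have := (h2 (-k - 2)).symm
        rw [show -k - 2 + 2 = -k by ring] at this
        rwa [show -(k + 2) = -k - 2 by ring])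
      (fun k hk => h3 (-k - 3) (by
        rw [show -k - 3 + 3 = -k by ring]
        rw [show -(k + 3) = -k - 3 by ring] at hk
        exact hk.symm))
      (-i - 1) (by rw [← hc]; congr 1; ring) (by rw [← ha]; congr 1; ring)
  have e1 := h1 (i - 1)
  have e2 := h1 i
  have d := h2 (i - 1)
  rw [show i - 1 + 1 = i by ring] at e1
  rw [show i - 1 + 2 = i + 1 by ring] at d
  rw [hc] at e1 e2
  clear h1 h2 h3 hc
  rcases hg : g (i - 1) with _ | _ | _ | _ <;> rcases hg' : g (i + 1) with _ | _ | _ | _ <;>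
    simp_all [J'Graph, J'Rel]

/-- A walk as in `J'Graph_walk_not_c_a` contains no `x`-type vertex. -/
lemma J'Graph_walk_not_x {n m : ℕ} (I : NAE n m) (g : ℤ → JV' n m)
    (h1 : ∀ i, (J'Graph I).Adj (g i) (g (i + 1)))
    (h2 : ∀ i, g i ≠ g (i + 2))
    (h3 : ∀ i, ¬ (J'Graph I).Adj (g i) (g (i + 3)))
    (i : ℤ) (k : Fin n) : g i ≠ .x k := by
  intro hx
  have not_c := J'Graph_walk_not_c I g h1 h2 h3
  have e1 := h1 i
  have e2 := h1 (i + 1)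
  have e3 := h1 (i + 2)
  have t := h3 i
  have c1 := not_c (i + 1)
  have c3 := not_c (i + 3)
  rw [show i + 1 + 1 = i + 2 by ring] at e2
  rw [show i + 2 + 1 = i + 3 by ring] at e3
  clear not_c h1 h2 h3
  rcases hg1 : g (i + 1) with _ | _ | _ | _ <;> rcases hg2 : g (i + 2) with _ | _ | _ | _ <;>
    rcases hg3 : g (i + 3) with _ | _ | _ | _ <;>
    simp_all [J'Graph, J'Rel]

/-- In a walk as in `J'Graph_walk_not_c_a`, every `a`-type vertex is the middle vertex of its
clause component. -/
lemma J'Graph_walk_a_eq_one {n m : ℕ} (I : NAE n m) (g : ℤ → JV' n m)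
    (h1 : ∀ i, (J'Graph I).Adj (g i) (g (i + 1)))
    (h2 : ∀ i, g i ≠ g (i + 2))
    (h3 : ∀ i, ¬ (J'Graph I).Adj (g i) (g (i + 3)))
    (i : ℤ) {j : Fin m} {p : Bool} {h : Fin 3} (ha : g i = .a j p h) : h = 1 := by
  have not_c := J'Graph_walk_not_c I g h1 h2 h3
  have e1 := h1 (i - 1)
  have e2 := h1 i
  have d := h2 (i - 1)
  have c1 := not_c (i - 1)
  have c2 := not_c (i + 1)
  rw [show i - 1 + 1 = i by ring] at e1
  rw [show i - 1 + 2 = i + 1 by ring] at d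
  rw [ha] at e1 e2
  clear not_c h1 h2 h3 ha
  generalize g (i - 1) = u at *
  generalize g (i + 1) = v at *
  rcases u with _ | ⟨_, _, q⟩ | _ | _ <;> rcases v with _ | ⟨_, _, r⟩ | _ | _ <;>
    simp [J'Graph, J'Rel] at e1 e2 c1 c2
  obtain ⟨rfl, rfl, e1⟩ := e1
  obtain ⟨rfl, rfl, e2⟩ := e2
  simp only [ne_eq, JV'.b.injEq, true_and] at d
  revert e1 e2 d
  decide +revert

/-- There is no walk as in `J'Graph_walk_not_c_a`. -/
lemma J'Graph_no_walk {n m : ℕ} (I : NAE n m) (g : ℤ → JV' n m)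
    (h1 : ∀ i, (J'Graph I).Adj (g i) (g (i + 1)))
    (h2 : ∀ i, g i ≠ g (i + 2))
    (h3 : ∀ i, ¬ (J'Graph I).Adj (g i) (g (i + 3))) : False := by
  have not_c := J'Graph_walk_not_c I g h1 h2 h3
  have not_x := J'Graph_walk_not_x I g h1 h2 h3
  have not_b : ∀ i j p h, g i ≠ .b j p h := by
    intro i j p h hb
    have e1 := h1 (i - 1)
    have e2 := h1 i
    have d := h2 (i - 1)
    have x1 := not_x (i - 1)
    have x2 := not_x (i + 1)
    have a1 := @J'Graph_walk_a_eq_one n m I g h1 h2 h3 (i - 1)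
    have a2 := @J'Graph_walk_a_eq_one n m I g h1 h2 h3 (i + 1)
    rw [show i - 1 + 1 = i by ring] at e1
    rw [show i - 1 + 2 = i + 1 by ring] at d
    clear not_c not_x h1 h2 h3
    rcases hg : g (i - 1) with ⟨_, _, q⟩ | _ | _ | _ <;>
      rcases hg' : g (i + 1) with ⟨_, _, r⟩ | _ | _ | _ <;>
      simp_all [J'Graph, J'Rel]
  have e := h1 0
  rcases hg : g 0 with _ | _ | _ | _ <;> rcases hg' : g (0 + 1) with _ | _ | _ | _ <;>
    simp_all [J'Graph, J'Rel]

/- Statement 4 -/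
theorem stmt4 {n m : ℕ} (I : NAE n m) : ChordalBipartite (J'Graph I) := by
  refine ⟨J'Graph_colorable_two I, fun s hs hs4 => ⟨fun f => ?_⟩⟩
  obtain ⟨t, rfl⟩ : ∃ t, s = t + 2 := ⟨s - 2, by omega⟩
  have adj_iff (u v : ZMod (t + 2)) :
      (J'Graph I).Adj (f u) (f v) ↔ u - v = 1 ∨ v - u = 1 :=
    f.map_adj_iff.trans cycleGraph_adj
  have two_ne : ((2 : ℕ) : ZMod (t + 2)) ≠ 0 := by
    rw [Ne, ZMod.natCast_eq_zero_iff]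
    intro hd
    have := Nat.le_of_dvd two_pos hd
    omega
  have four_ne : ((4 : ℕ) : ZMod (t + 2)) ≠ 0 := by
    rw [Ne, ZMod.natCast_eq_zero_iff]
    intro hd
    have := Nat.le_of_dvd four_pos hd
    obtain rfl : t = 1 := by omega
    omega
  push_cast at two_ne four_ne
  refine J'Graph_no_walk I (fun i => f (i : ZMod (t + 2))) (fun i => ?_)
    (fun i hi => ?_) (fun i hi => ?_)
  · rw [adj_iff]
    right
    push_cast
    ring
  · have := f.injective hi
    push_cast at this
    exact two_ne (left_eq_add.mp this)
  · rw [adj_iff] at hi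
    push_cast at hi
    rcases hi with hi | hi
    · exact four_ne (by linear_combination -hi)
    · exact two_ne (by linear_combination hi)
end

section
/- The graph J_I' has a proper colouring that respects the list assignment L' if and only if the instance I has a truth assignment in which each clause contains at least one true and at least one false variable. -/
open SimpleGraph

/-- A list colouring of a clause component uses its non-`{3,4}` colour on some `a`-vertex. -/
lemma exists_a_eq_of_listColouring {n m : ℕ} {I : NAE n m} {c : JV' n m → ℕ}
    (hc : ∀ u v, (J'Graph I).Adj u v → c u ≠ c v) (hL : ∀ u, c u ∈ L'assign u)
    (j : Fin m) (p : Bool) : ∃ h : Fin 3, c (.a j p h) = if p then 1 else 2 := by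
  have adj (h : Fin 3) (k : Fin 2) (hk : h = k.castSucc ∨ h = k.succ) :
      c (.a j p h) ≠ c (.b j p k) :=
    hc _ _ (by simp [J'Graph, J'Rel, hk])
  have e00 := adj 0 0 (by decide)
  have e10 := adj 1 0 (by decide)
  have e11 := adj 1 1 (by decide)
  have e21 := adj 2 1 (by decide)
  have a0 := hL (.a j p 0)
  have a1 := hL (.a j p 1)
  have a2 := hL (.a j p 2)
  have b0 := hL (.b j p 0)
  have b1 := hL (.b j p 1)
  by_contra! hne
  have n0 := hne 0
  have n1 := hne 1
  have n2 := hne 2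
  cases p <;> simp [L'assign] at a0 a1 a2 b0 b1 n0 n1 n2 <;> omega

/-- If the `a`-vertex has the non-`{3,4}` colour of its component, so does the variable vertex
at the other end of the subdivided edge. -/
lemma x_eq_of_a_eq {n m : ℕ} {I : NAE n m} {c : JV' n m → ℕ}
    (hc : ∀ u v, (J'Graph I).Adj u v → c u ≠ c v) (hL : ∀ u, c u ∈ L'assign u)
    {j : Fin m} {p : Bool} {h : Fin 3} (ha : c (.a j p h) = if p then 1 else 2) :
    c (.x (I.clause j h)) = if p then 1 else 2 := by
  have hca : c (.c j p h) ≠ c (.a j p h) := hc _ _ (by simp [J'Graph, J'Rel])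
  have hcx : c (.c j p h) ≠ c (.x (I.clause j h)) := hc _ _ (by simp [J'Graph, J'Rel])
  have hlc := hL (.c j p h)
  have hlx := hL (.x (I.clause j h))
  simp only [L'assign, Finset.mem_insert, Finset.mem_singleton] at hlc hlx
  cases p <;> simp at ha ⊢ <;> omega

/-- The colouring of `J_I'` induced by a truth assignment: true variables receive colour `2`,
false ones colour `1`. -/
def assignmentColouring {n m : ℕ} (I : NAE n m) (τ : Fin n → Bool) : JV' n m → ℕ
  | .a j p h =>
      if τ (I.clause j h) = !p then (if p then 1 else 2)
      else if h = 0 then 4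
      else if h = 1 then (if τ (I.clause j 0) = !p then 3 else 4)
      else 3
  | .b j p k =>
      if τ (I.clause j 0) = (!p) ∨ k = 1 ∧ τ (I.clause j 1) = !p then 4 else 3
  | .x i => if τ i then 2 else 1
  | .c j _ h => if τ (I.clause j h) then 1 else 2

lemma assignmentColouring_mem {n m : ℕ} (I : NAE n m) (τ : Fin n → Bool) (u : JV' n m) :
    assignmentColouring I τ u ∈ L'assign u := by
  cases u with
  | a j p h =>
    fin_cases h <;> cases p <;> simp [assignmentColouring, L'assign] <;> split_ifs <;> simp_all
  | b j p k => simp only [assignmentColouring, L'assign]; split_ifs <;> simp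
  | x i => simp only [assignmentColouring, L'assign]; split_ifs <;> simp
  | c j p h => simp only [assignmentColouring, L'assign]; split_ifs <;> simp

lemma assignmentColouring_ne_of_rel {n m : ℕ} {I : NAE n m} {τ : Fin n → Bool}
    (hτ : ∀ j p, ∃ h, τ (I.clause j h) = p) {u v : JV' n m} (huv : J'Rel I u v) :
    assignmentColouring I τ u ≠ assignmentColouring I τ v := by
  match u, v, huv with
  | .a j p h, .b _ _ k, ⟨rfl, rfl, hk⟩ =>
    obtain ⟨i, hi⟩ := hτ j (!p)
    fin_cases h <;> fin_cases k <;> simp at hk <;>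
      fin_cases i <;> cases p <;> simp_all [assignmentColouring] <;> split_ifs <;> simp_all
  | .c j p h, .a _ _ _, ⟨rfl, rfl, rfl⟩ =>
    simp only [assignmentColouring]
    cases p <;> cases τ (I.clause j h) <;> simp <;> split_ifs <;> simp
  | .c j p h, .x _, rfl =>
    simp only [assignmentColouring]
    split_ifs <;> simp
  | .x i, .b j p k, _ =>
    simp only [assignmentColouring]
    split_ifs <;> simp

/- Statement 5 -/
theorem stmt5 {n m : ℕ} (I : NAE n m) :
    (∃ c : JV' n m → ℕ, (∀ u v, (J'Graph I).Adj u v → c u ≠ c v) ∧ ∀ u, c u ∈ L'assign u) ↔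
      I.Satisfiable := by
  constructor
  · rintro ⟨c, hc, hL⟩
    refine ⟨fun i => decide (c (.x i) = 2), fun j => ⟨?_, ?_⟩⟩
    · obtain ⟨h, ha⟩ := exists_a_eq_of_listColouring hc hL j false
      exact ⟨h, by simpa using x_eq_of_a_eq hc hL ha⟩
    · obtain ⟨h, ha⟩ := exists_a_eq_of_listColouring hc hL j true
      exact ⟨h, by simp [x_eq_of_a_eq hc hL ha]⟩
  · rintro ⟨τ, hτ⟩
    have hτ' : ∀ j p, ∃ h, τ (I.clause j h) = p := by
      rintro j (_ | _)
      exacts [(hτ j).2, (hτ j).1]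
    refine ⟨assignmentColouring I τ, fun u v huv => ?_, assignmentColouring_mem I τ⟩
    obtain ⟨-, h | h⟩ := (fromRel_adj _ _ _).1 huv
    · exact assignmentColouring_ne_of_rel hτ' h
    · exact (assignmentColouring_ne_of_rel hτ' h).symm
end

section
/- For every integer k ≥ 4, the graph J_I^k is P_10-free and chordal bipartite. -/
open SimpleGraph

namespace JV'

variable {n m : ℕ}

/-- The four types of vertices of `J_I'`. -/
inductive Kind where
  | a | b | x | c
  deriving DecidableEq

instance : Fintype Kind := ⟨{.a, .b, .x, .c}, by rintro (_ | _ | _ | _) <;> decide⟩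

/-- The type of a vertex of `J_I'`. -/
def kind_s6 : JV' n m → Kind
  | .a _ _ _ => .a
  | .b _ _ _ => .b
  | .x _ => .x
  | .c _ _ _ => .c

/-- The pairs of types that occur on the ends of an edge of `J_I'`. -/
def Kind.Compat : Kind → Kind → Bool
  | .a, .b | .b, .a | .c, .a | .a, .c | .c, .x | .x, .c | .x, .b | .b, .x => true
  | _, _ => false

theorem compat_of_adj {I : NAE n m} {u v : JV' n m} (h : (J'Graph I).Adj u v) :
    u.kind_s6.Compat v.kind_s6 := by
  cases u <;> cases v <;> simp_all [J'Graph, J'Rel, kind_s6, Kind.Compat]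

/-- The triples of types that cannot occur on a path of `J_I'` on three vertices. -/
def Kind.Blocked : Kind → Kind → Kind → Bool
  | .a, .c, .a | .x, .c, .x | .c, .a, .c => true
  | _, _, _ => false

theorem not_blocked {I : NAE n m} {u v w : JV' n m} (huv : (J'Graph I).Adj u v)
    (hvw : (J'Graph I).Adj v w) (huw : u ≠ w) : ¬Kind.Blocked u.kind_s6 v.kind_s6 w.kind_s6 := by
  cases u <;> cases v <;> cases w <;> simp_all [J'Graph, J'Rel, kind_s6, Kind.Blocked]

/-- The pairs of types that occur only on the ends of an edge of `J_I'`. -/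
def Kind.Complete : Kind → Kind → Bool
  | .b, .x | .x, .b => true
  | _, _ => false

theorem not_complete_of_not_adj {I : NAE n m} {u v : JV' n m} (huv : ¬(J'Graph I).Adj u v) :
    ¬Kind.Complete u.kind_s6 v.kind_s6 := by
  cases u <;> cases v <;> simp_all [J'Graph, J'Rel, kind_s6, Kind.Complete]

/-- The sequence of types of a path that alternates between `b`- and `a`-type vertices. -/
def Kind.Alternating : Kind → Kind → Kind → Kind → Kind → Bool
  | .b, .a, .b, .a, .b => true
  | _, _, _, _, _ => false

theorem eq_of_alternating {I : NAE n m} {u₀ u₁ u₂ u₃ u₄ : JV' n m}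
    (h₀₁ : (J'Graph I).Adj u₀ u₁) (h₁₂ : (J'Graph I).Adj u₁ u₂) (h₂₃ : (J'Graph I).Adj u₂ u₃)
    (h₃₄ : (J'Graph I).Adj u₃ u₄) (h₀₂ : u₀ ≠ u₂) (h₂₄ : u₂ ≠ u₄)
    (h : Kind.Alternating u₀.kind_s6 u₁.kind_s6 u₂.kind_s6 u₃.kind_s6 u₄.kind_s6) : u₀ = u₄ := by
  cases u₀ <;> try simp [kind_s6, Kind.Alternating] at h
  cases u₁ <;> try cases h
  cases u₂ <;> try cases h
  cases u₃ <;> try cases h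
  cases u₄ <;> try cases h
  simp only [J'Graph, J'Rel, fromRel_adj, ne_eq, JV'.b.injEq] at *
  grind

theorem Kind.no_sequence : ∀ k₀ k₁ : Kind, k₀.Compat k₁ →
    ∀ k₂, k₁.Compat k₂ → ¬Blocked k₀ k₁ k₂ →
    ∀ k₃, k₂.Compat k₃ → ¬Blocked k₁ k₂ k₃ → ¬Complete k₀ k₃ →
    ∀ k₄, k₃.Compat k₄ → ¬Blocked k₂ k₃ k₄ → ¬Complete k₁ k₄ → ¬Alternating k₀ k₁ k₂ k₃ k₄ →
    ∀ k₅, k₄.Compat k₅ → ¬Blocked k₃ k₄ k₅ → ¬Complete k₂ k₅ → ¬Alternating k₁ k₂ k₃ k₄ k₅ →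
    ∀ k₆, k₅.Compat k₆ → ¬Blocked k₄ k₅ k₆ → ¬Complete k₃ k₆ → ¬Alternating k₂ k₃ k₄ k₅ k₆ →
    ∀ k₇, k₆.Compat k₇ → ¬Blocked k₅ k₆ k₇ → ¬Complete k₄ k₇ → ¬Alternating k₃ k₄ k₅ k₆ k₇ →
    False := by
  decide

/-- `J_I'` has no walk on eight vertices in which vertices at distance two along the walk are
distinct and vertices at distance three along the walk are not adjacent. -/
theorem no_locally_induced_walk (I : NAE n m) (f : ℕ → JV' n m)
    (h₁ : ∀ i < 7, (J'Graph I).Adj (f i) (f (i + 1)))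
    (h₂ : ∀ i < 6, f i ≠ f (i + 2))
    (h₃ : ∀ i < 5, ¬(J'Graph I).Adj (f i) (f (i + 3))) : False := by
  have adj (i : ℕ) (hi : i < 7) := compat_of_adj (h₁ i hi)
  have blocked (i : ℕ) (hi : i < 6) :=
    not_blocked (h₁ i (by omega)) (h₁ (i + 1) (by omega)) (h₂ i hi)
  have far (i : ℕ) (hi : i < 5) := not_complete_of_not_adj (h₃ i hi)
  have alt (i : ℕ) (hi : i < 4) : ¬Kind.Alternating (f i).kind_s6 (f (i + 1)).kind_s6
      (f (i + 2)).kind_s6 (f (i + 3)).kind_s6 (f (i + 4)).kind_s6 := by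
    intro h
    have := eq_of_alternating (h₁ i (by omega)) (h₁ (i + 1) (by omega)) (h₁ (i + 2) (by omega))
      (h₁ (i + 3) (by omega)) (h₂ i (by omega)) (h₂ (i + 2) (by omega)) h
    refine h₃ (i + 1) (by omega) ?_
    rw [show i + 1 + 3 = i + 4 by rfl, ← this]
    exact (h₁ i (by omega)).symm
  exact Kind.no_sequence _ _ (adj 0 (by omega)) _ (adj 1 (by omega)) (blocked 0 (by omega))
    _ (adj 2 (by omega)) (blocked 1 (by omega)) (far 0 (by omega))
    _ (adj 3 (by omega)) (blocked 2 (by omega)) (far 1 (by omega)) (alt 0 (by omega))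
    _ (adj 4 (by omega)) (blocked 3 (by omega)) (far 2 (by omega)) (alt 1 (by omega))
    _ (adj 5 (by omega)) (blocked 4 (by omega)) (far 3 (by omega)) (alt 2 (by omega))
    _ (adj 6 (by omega)) (blocked 5 (by omega)) (far 4 (by omega)) (alt 3 (by omega))

theorem isAX_ne_of_adj {I : NAE n m} {u v : JV' n m} (h : (J'Graph I).Adj u v) :
    u.isAX ≠ v.isAX := by
  cases u <;> cases v <;> simp_all [J'Graph, J'Rel, isAX]

end JV'

namespace JVK

variable {n m k : ℕ}

theorem adj_orig {I : NAE n m} {u v : JV' n m} :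
    (JKGraph I k).Adj (.orig u) (.orig v) ↔ (J'Graph I).Adj u v := by
  simp [JKGraph, JKRel, J'Graph]

/-- A vertex with two distinct neighbours is not pendant. -/
theorem exists_eq_orig {I : NAE n m} {u v w : JVK n m k} (huv : (JKGraph I k).Adj u v)
    (hvw : (JKGraph I k).Adj v w) (huw : u ≠ w) : ∃ v', v = .orig v' := by
  cases v with
  | orig v' => exact ⟨v', rfl⟩
  | pend v' i => cases u <;> cases w <;> simp_all [JKGraph, JKRel]

theorem no_locally_induced_walk (I : NAE n m) (f : ℕ → JVK n m k)
    (h₁ : ∀ i < 9, (JKGraph I k).Adj (f i) (f (i + 1)))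
    (h₂ : ∀ i < 8, f i ≠ f (i + 2))
    (h₃ : ∀ i < 7, ¬(JKGraph I k).Adj (f i) (f (i + 3))) : False := by
  have key (i : Fin 8) : ∃ v, f (i + 1) = .orig v :=
    exists_eq_orig (h₁ i (by omega)) (h₁ (i + 1) (by omega)) (h₂ i (by omega))
  choose g hg using key
  have hg' (i : ℕ) (hi : i < 8) : f (i + 1) = .orig (g (Fin.ofNat 8 i)) := by
    rw [← hg, Fin.val_ofNat, Nat.mod_eq_of_lt hi]
  refine JV'.no_locally_induced_walk I (fun i => g (Fin.ofNat 8 i)) (fun i hi => ?_)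
    (fun i hi h => ?_) (fun i hi h => ?_)
  · rw [← adj_orig (k := k), ← hg' i (by omega), ← hg' (i + 1) (by omega)]
    exact h₁ (i + 1) (by omega)
  · apply h₂ (i + 1) (by omega)
    rw [hg' i (by omega), show i + 1 + 2 = i + 2 + 1 by rfl, hg' (i + 2) (by omega)]
    exact congrArg _ h
  · apply h₃ (i + 1) (by omega)
    rw [hg' i (by omega), show i + 1 + 3 = i + 3 + 1 by rfl, hg' (i + 3) (by omega)]
    exact adj_orig.2 h

/-- The bipartition of `J_I^k`. -/
def side : JVK n m k → Bool
  | .orig v => v.isAX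
  | .pend v _ => !v.isAX

theorem side_ne_of_adj {I : NAE n m} {u v : JVK n m k} (h : (JKGraph I k).Adj u v) :
    u.side ≠ v.side := by
  cases u with
  | orig u =>
    cases v with
    | orig v => exact JV'.isAX_ne_of_adj (adj_orig.1 h)
    | pend v i => simp_all [JKGraph, JKRel, side]
  | pend u i => cases v <;> simp_all [JKGraph, JKRel, side]

theorem isEmpty_pathGraph_embedding (I : NAE n m) :
    IsEmpty (pathGraph 10 ↪g JKGraph I k) := by
  refine ⟨fun φ => no_locally_induced_walk I (fun i => φ (Fin.ofNat 10 i))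
    (fun i hi => ?_) (fun i hi h => ?_) (fun i hi h => ?_)⟩
  · rw [φ.map_adj_iff, pathGraph_adj]
    simp only [Fin.val_ofNat]
    omega
  · have := congrArg Fin.val (φ.injective h)
    simp only [Fin.val_ofNat] at this
    omega
  · rw [φ.map_adj_iff, pathGraph_adj] at h
    simp only [Fin.val_ofNat] at h
    omega

theorem isEmpty_cycleGraph_embedding (I : NAE n m) (s : ℕ) (hs : 5 ≤ s) :
    IsEmpty (cycleGraph s ↪g JKGraph I k) := by
  have : NeZero s := ⟨by omega⟩
  have sub_eq (i d : ℕ) : Fin.ofNat s (i + d) - Fin.ofNat s i = Fin.ofNat s d := by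
    open scoped Fin.CommRing in
    change ((i + d : ℕ) : Fin s) - (i : Fin s) = (d : Fin s)
    push_cast
    ring
  have sub_eq_neg (i d : ℕ) : Fin.ofNat s i - Fin.ofNat s (i + d) = - Fin.ofNat s d := by
    open scoped Fin.CommRing in
    rw [← sub_eq i d, neg_sub]
  refine ⟨fun φ => no_locally_induced_walk I (fun i => φ (Fin.ofNat s i))
    (fun i hi => ?_) (fun i hi h => ?_) (fun i hi h => ?_)⟩
  · rw [φ.map_adj_iff, cycleGraph_adj', sub_eq]
    right
    rw [Fin.val_ofNat, Nat.mod_eq_of_lt (by omega)]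
  · have := sub_eq i 2
    rw [← φ.injective h, Fin.sub_self] at this
    have := congrArg Fin.val this
    rw [Fin.val_ofNat, Nat.mod_eq_of_lt (by omega)] at this
    simp at this
  · rw [φ.map_adj_iff, cycleGraph_adj', sub_eq, sub_eq_neg, Fin.val_neg', Fin.val_ofNat,
      Nat.mod_eq_of_lt (show 3 < s by omega), Nat.mod_eq_of_lt (show s - 3 < s by omega)] at h
    omega

end JVK

/- Statement 6 -/
theorem stmt6 {n m : ℕ} (I : NAE n m) (k : ℕ) (hk : 4 ≤ k) :
    IsEmpty (pathGraph 10 ↪g JKGraph I k) ∧ ChordalBipartite (JKGraph I k) := by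
  refine ⟨JVK.isEmpty_pathGraph_embedding I, ?_, fun s hs hs4 => ?_⟩
  · exact (Coloring.mk JVK.side JVK.side_ne_of_adj).colorable
  · obtain rfl | hs5 : s = 3 ∨ 5 ≤ s := by omega
    · refine ⟨fun φ => ?_⟩
      have h (i j : Fin 3) (hij : (cycleGraph 3).Adj i j) :=
        JVK.side_ne_of_adj (φ.map_adj_iff.2 hij)
      have h₀₁ := h 0 1 (by decide)
      have h₁₂ := h 1 2 (by decide)
      have h₀₂ := h 0 2 (by decide)
      cases h₀ : (φ 0).side <;> cases h₁ : (φ 1).side <;> cases h₂ : (φ 2).side <;> simp_all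
    · exact JVK.isEmpty_cycleGraph_embedding I s hs5
end

section
/- For every integer k ≥ 4, the graph J_I^k has a proper k-colouring extending the precolouring c_{W^k} if and only if the instance I has a truth assignment in which each clause contains at least one true and at least one false variable. -/
open SimpleGraph

theorem L'assign_subset {n m k : ℕ} (hk : 4 ≤ k) (v : JV' n m) :
    L'assign v ⊆ Finset.Icc 1 k := by
  have h4 : L'assign v ⊆ Finset.Icc 1 4 := by
    cases v with
    | a j p h => simp only [L'assign]; revert p h; decide
    | b j p h => simp only [L'assign]; decide
    | x i => simp only [L'assign]; decide
    | c j p h => simp only [L'assign]; decide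
  exact h4.trans (Finset.Icc_subset_Icc_right hk)

/-- An injective family of `k - |L|` colours outside `L` exhausts the complement of `L`. -/
theorem image_eq_sdiff_of_injective {k : ℕ} {L : Finset ℕ} (hL : L ⊆ Finset.Icc 1 k)
    {f : Fin (k - L.card) → ℕ} (hf : Function.Injective f)
    (hmem : ∀ i, f i ∈ Finset.Icc 1 k \ L) :
    Finset.univ.image f = Finset.Icc 1 k \ L := by
  apply Finset.eq_of_subset_of_card_le
  · simpa [Finset.subset_iff] using hmem
  · rw [Finset.card_image_of_injective _ hf, Finset.card_sdiff_of_subset hL]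
    simp

/-- Colours of the `a`-vertices of a clause component with private colour `s`, where `q h` says
that the private colour is available at the `h`-th `a`-vertex. -/
def aColour (s : ℕ) (q : Fin 3 → Bool) : Fin 3 → ℕ :=
  if q 0 then ![s, 3, 3] else if q 2 then ![4, 4, s] else ![4, s, 3]

/-- Colours of the `b`-vertices matching `aColour`. -/
def bColour (q : Fin 3 → Bool) : Fin 2 → ℕ :=
  if q 0 then ![4, 4] else if q 2 then ![3, 3] else ![3, 4]

/-- The colour in `{1, 2}` encoding a truth value. -/
def boolColour (t : Bool) : ℕ := if t then 1 else 2

/-- The list colouring of `J_I'` associated with a truth assignment. -/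
def colouringOf {n m : ℕ} (I : NAE n m) (τ : Fin n → Bool) : JV' n m → ℕ
  | .a j p h => aColour (boolColour p) (fun h => τ (I.clause j h) == p) h
  | .b j p h => bColour (fun h => τ (I.clause j h) == p) h
  | .x i => boolColour (τ i)
  | .c j _ h => boolColour (!τ (I.clause j h))

theorem aColour_ne_bColour (p : Bool) (q : Fin 3 → Bool) (h : Fin 3) (h' : Fin 2)
    (hh : h = h'.castSucc ∨ h = h'.succ) : aColour (boolColour p) q h ≠ bColour q h' := by
  rcases hh with rfl | rfl <;> fin_cases h' <;> cases p <;> unfold aColour bColour boolColour <;>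
    split_ifs <;> simp_all

theorem boolColour_ne_aColour (p : Bool) (t : Fin 3 → Bool) (ht : ∃ h, t h = p) (h : Fin 3) :
    boolColour (!t h) ≠ aColour (boolColour p) (fun h => t h == p) h := by
  simp only [Fin.exists_fin_succ, Fin.exists_fin_zero] at ht
  fin_cases h <;> cases p <;> unfold aColour boolColour <;> split_ifs <;> simp_all

theorem colouringOf_mem {n m : ℕ} (I : NAE n m) (τ : Fin n → Bool) (v : JV' n m) :
    colouringOf I τ v ∈ L'assign v := by
  cases v with
  | a j p h =>
    cases p <;> fin_cases h <;> simp only [colouringOf, L'assign, aColour, boolColour] <;>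
      split_ifs <;> simp_all
  | b j p h =>
    fin_cases h <;> simp only [colouringOf, L'assign, bColour] <;> split_ifs <;> simp
  | x i => cases ht : τ i <;> simp [colouringOf, L'assign, boolColour, ht]
  | c j p h => cases ht : τ (I.clause j h) <;> simp [colouringOf, L'assign, boolColour, ht]

theorem colouringOf_ne {n m : ℕ} {I : NAE n m} {τ : Fin n → Bool}
    (hτ : ∀ j, (∃ h, τ (I.clause j h) = true) ∧ (∃ h, τ (I.clause j h) = false))
    {u v : JV' n m} (huv : J'Rel I u v) : colouringOf I τ u ≠ colouringOf I τ v := by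
  cases u <;> cases v <;> simp only [J'Rel] at huv
  case a.b j p h j' p' h' =>
    obtain ⟨rfl, rfl, hh⟩ := huv
    exact aColour_ne_bColour p (fun h => τ (I.clause j h) == p) h h' hh
  case x.b i j p h =>
    fin_cases h <;> simp only [colouringOf, bColour, boolColour] <;> split_ifs <;> simp
  case c.a j p h j' p' h' =>
    obtain ⟨rfl, rfl, rfl⟩ := huv
    refine boolColour_ne_aColour p (fun h => τ (I.clause j h)) ?_ h
    cases p
    · exact (hτ j).2
    · exact (hτ j).1
  case c.x j p h i =>
    subst huv
    cases ht : τ (I.clause j h) <;> simp [colouringOf, boolColour, ht]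

/-- In a list colouring of `J_I'`, the variables of a clause do not all receive the colour
that the component `p` forbids. -/
theorem exists_x_colour_eq {n m : ℕ} {I : NAE n m} {d : JV' n m → ℕ}
    (hd : ∀ u v, J'Rel I u v → d u ≠ d v) (hL : ∀ v, d v ∈ L'assign v) (j : Fin m) (p : Bool) :
    ∃ h, d (.x (I.clause j h)) = boolColour p := by
  by_contra! hne
  have hx h := hL (.x (I.clause j h))
  have hc h := hL (.c j p h)
  have hcx h := hd (.c j p h) (.x (I.clause j h)) rfl
  have hca h := hd (.c j p h) (.a j p h) ⟨rfl, rfl, rfl⟩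
  have hane h : d (.a j p h) ≠ boolColour p := by
    have h1 := hne h
    have h2 := hx h
    have h3 := hc h
    have h4 := hcx h
    have h5 := hca h
    cases p <;> simp [L'assign, boolColour] at * <;> omega
  have ha0 := hL (.a j p 0)
  have ha1 := hL (.a j p 1)
  have ha2 := hL (.a j p 2)
  have hb0 := hL (.b j p 0)
  have hb1 := hL (.b j p 1)
  have e00 := hd (.a j p 0) (.b j p 0) ⟨rfl, rfl, Or.inl rfl⟩
  have e10 := hd (.a j p 1) (.b j p 0) ⟨rfl, rfl, Or.inr rfl⟩
  have e11 := hd (.a j p 1) (.b j p 1) ⟨rfl, rfl, Or.inl rfl⟩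
  have e21 := hd (.a j p 2) (.b j p 1) ⟨rfl, rfl, Or.inr rfl⟩
  have n0 := hane 0
  have n1 := hane 1
  have n2 := hane 2
  clear hne hx hc hcx hca hane hd hL
  cases p <;> simp [L'assign, boolColour] at * <;> omega

theorem exists_listColouring_iff {n m : ℕ} (I : NAE n m) :
    (∃ d : JV' n m → ℕ, (∀ u v, J'Rel I u v → d u ≠ d v) ∧ ∀ v, d v ∈ L'assign v) ↔
      I.Satisfiable := by
  constructor
  · rintro ⟨d, hd, hL⟩
    refine ⟨fun i => d (.x i) == 1, fun j => ⟨?_, ?_⟩⟩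
    · obtain ⟨h, hh⟩ := exists_x_colour_eq hd hL j true
      exact ⟨h, by simp [hh, boolColour]⟩
    · obtain ⟨h, hh⟩ := exists_x_colour_eq hd hL j false
      exact ⟨h, by simp [hh, boolColour]⟩
  · rintro ⟨τ, hτ⟩
    exact ⟨colouringOf I τ, fun _ _ => colouringOf_ne hτ, colouringOf_mem I τ⟩

theorem J'Rel_irrefl {n m : ℕ} (I : NAE n m) (u : JV' n m) : ¬ J'Rel I u u := by
  cases u <;> simp [J'Rel]

/- Statement 7 -/
theorem stmt7 {n m : ℕ} (I : NAE n m) (k : ℕ) (hk : 4 ≤ k)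
    (cW : (v : JV' n m) → Fin (k - (L'assign v).card) → ℕ)
    (hinj : ∀ v, Function.Injective (cW v))
    (hmem : ∀ v i, cW v i ∈ Finset.Icc 1 k \ L'assign v) :
    (∃ c : JVK n m k → ℕ,
        (∀ u v, (JKGraph I k).Adj u v → c u ≠ c v) ∧
        (∀ u, c u ∈ Finset.Icc 1 k) ∧
        (∀ v i, c (.pend v i) = cW v i)) ↔
      I.Satisfiable := by
  rw [← exists_listColouring_iff]
  constructor
  · rintro ⟨c, hadj, hrange, hpend⟩
    refine ⟨fun v => c (.orig v), fun u v huv => hadj _ _ ?_, fun v => ?_⟩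
    · rw [JKGraph, fromRel_adj]
      refine ⟨?_, Or.inl huv⟩
      rintro ⟨⟩
      exact J'Rel_irrefl I u huv
    · by_contra hv
      have hmem' : c (.orig v) ∈ Finset.univ.image (cW v) := by
        rw [image_eq_sdiff_of_injective (L'assign_subset hk v) (hinj v) (hmem v)]
        exact Finset.mem_sdiff.2 ⟨hrange _, hv⟩
      obtain ⟨i, -, hi⟩ := Finset.mem_image.1 hmem'
      refine hadj (.pend v i) (.orig v) ?_ ((hpend v i).trans hi)
      rw [JKGraph, fromRel_adj]
      exact ⟨by simp, Or.inl rfl⟩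
  · rintro ⟨d, hd, hL⟩
    let c : JVK n m k → ℕ
      | .orig v => d v
      | .pend v i => cW v i
    have hc u v (huv : JKRel I u v) : c u ≠ c v := by
      rcases u with u | ⟨u, i⟩ <;> rcases v with v | ⟨v, i'⟩ <;> simp only [JKRel] at huv
      · exact hd u v huv
      · subst huv
        exact fun h => (Finset.mem_sdiff.1 (hmem v i)).2 ((show cW v i = d v from h) ▸ hL v)
    refine ⟨c, fun u v huv => ?_, ?_, fun _ _ => rfl⟩
    · rw [JKGraph, fromRel_adj] at huv
      exact huv.2.elim (hc u v) fun h => (hc v u h).symm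
    · rintro (v | ⟨v, i⟩)
      · exact L'assign_subset hk v (hL v)
      · exact (Finset.mem_sdiff.1 (hmem v i)).1
end

section
/- For every proper 4-colouring φ of M' (with colours from {1,2,3,4}), one has φ(17) = φ(23), and moreover {φ(2), φ(4), φ(11), φ(17)} = {φ(2), φ(4), φ(11), φ(23)} = {1, 2, 3, 4}. -/
open SimpleGraph

instance : DecidableRel M5.Adj := fun u v =>
  decidable_of_iff _ (fromRel_adj _ u v).symm

/-- If `H` contains the image of `G` under `f`, a shadow `u a` of every vertex `a` of `G`
adjacent to the neighbours of `a`, and an apex `w` adjacent to all shadows, then colouring `G`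
requires fewer colours than colouring `H`. -/
theorem colorable_of_mycielskian {V W : Type*} {G : SimpleGraph V} {H : SimpleGraph W}
    (f u : V → W) (w : W) (hf : ∀ a b, G.Adj a b → H.Adj (f a) (f b))
    (hu : ∀ a b, G.Adj a b → H.Adj (u a) (f b)) (hw : ∀ a, H.Adj (u a) w) {n : ℕ}
    (h : H.Colorable (n + 1)) : G.Colorable n := by
  obtain ⟨c⟩ := h
  let g : V → {x : Fin (n + 1) // x ≠ c w} := fun a =>
    if ha : c (f a) = c w then ⟨c (u a), c.valid (hw a)⟩ else ⟨c (f a), ha⟩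
  have hg : ∀ {a b}, G.Adj a b → g a ≠ g b := by
    intro a b hab
    have h₁ := c.valid (hf a b hab)
    have h₂ := c.valid (hu a b hab)
    have h₃ := c.valid (hu b a hab.symm)
    simp only [g]
    split_ifs with ha hb hb <;> simp only [ne_eq, Subtype.mk.injEq]
    · exact fun _ => h₁ (ha.trans hb.symm)
    · exact h₂
    · exact fun e => h₃ e.symm
    · exact h₁
  have hcol := (Coloring.mk g hg).colorable
  simpa using hcol

theorem M5_not_colorable_four : ¬ M5.Colorable 4 := by
  intro h
  let i₁₁ : Fin 11 → Fin 23 := Fin.castLE (by norm_num)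
  let i₅ : Fin 5 → Fin 11 := Fin.castLE (by norm_num)
  have h₄ : (M5.comap i₁₁).Colorable 3 :=
    colorable_of_mycielskian i₁₁ (fun a => Fin.castLE (by norm_num) (a.natAdd 11)) (vtx 23)
      (fun _ _ hab => hab) (by decide +kernel) (by decide +kernel) h
  have h₃ : ((M5.comap i₁₁).comap i₅).Colorable 2 :=
    colorable_of_mycielskian i₅ (fun a => Fin.castLE (by norm_num) (a.natAdd 5)) (10 : Fin 11)
      (fun _ _ hab => hab) (by decide +kernel) (by decide +kernel) h₄
  obtain ⟨c⟩ := h₃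
  have h12 := c.valid (v := 0) (w := 1) (by decide +kernel)
  have h23 := c.valid (v := 1) (w := 2) (by decide +kernel)
  have h35 := c.valid (v := 2) (w := 4) (by decide +kernel)
  have h54 := c.valid (v := 4) (w := 3) (by decide +kernel)
  have h41 := c.valid (v := 3) (w := 0) (by decide +kernel)
  omega

theorem Mp_adj_or_of_M5_adj {u v : Fin 23} (h : M5.Adj u v) :
    Mp.Adj u v ∨ (u = vtx 17 ∧ v = vtx 23) ∨ (u = vtx 23 ∧ v = vtx 17) := by
  simp only [M5, Mp, M5Edges, fromRel_adj, List.exists_mem_cons_iff] at h ⊢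
  obtain ⟨hne, (h | h) | h | h⟩ := h
  · exact Or.inr (Or.inl h)
  · exact Or.inl ⟨hne, Or.inl h⟩
  · exact Or.inr (Or.inr h.symm)
  · exact Or.inl ⟨hne, Or.inr h⟩

theorem Mp_coloring_eq (φ : Fin 23 → ℕ) (hproper : ∀ u v, Mp.Adj u v → φ u ≠ φ v)
    (hcol : ∀ v, 1 ≤ φ v ∧ φ v ≤ 4) : φ (vtx 17) = φ (vtx 23) := by
  by_contra hne
  refine M5_not_colorable_four
    ⟨Coloring.mk (fun v => (⟨φ v - 1, by have := hcol v; omega⟩ : Fin 4)) ?_⟩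
  intro u v huv heq
  have hφ : φ u = φ v := by
    have := hcol u
    have := hcol v
    have := congrArg Fin.val heq
    dsimp only at this
    omega
  rcases Mp_adj_or_of_M5_adj huv with h | ⟨rfl, rfl⟩ | ⟨rfl, rfl⟩
  · exact hproper u v h hφ
  · exact hne hφ
  · exact hne hφ.symm

instance : DecidableRel Mp.Adj := fun u v =>
  decidable_of_iff _ (fromRel_adj _ u v).symm

theorem Mp_adj_seventeen :
    ∀ v, Mp.Adj (vtx 17) v → v = vtx 2 ∨ v = vtx 4 ∨ v = vtx 11 := by
  decide +kernel

/-- Otherwise vertex `17` could be recoloured with a colour other than that of vertex `23`. -/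
theorem Mp_coloring_mem (φ : Fin 23 → ℕ) (hproper : ∀ u v, Mp.Adj u v → φ u ≠ φ v)
    (hcol : ∀ v, 1 ≤ φ v ∧ φ v ≤ 4) {c : ℕ} (hc : 1 ≤ c ∧ c ≤ 4) :
    c = φ (vtx 2) ∨ c = φ (vtx 4) ∨ c = φ (vtx 11) ∨ c = φ (vtx 23) := by
  by_contra! hne
  obtain ⟨h2, h4, h11, h23⟩ := hne
  have hnbr : ∀ v, Mp.Adj (vtx 17) v → c ≠ φ v := by
    intro v hv
    rcases Mp_adj_seventeen v hv with rfl | rfl | rfl <;> assumption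
  have key := Mp_coloring_eq (Function.update φ (vtx 17) c) ?_ ?_
  · rw [Function.update_self, Function.update_of_ne (by decide)] at key
    exact h23 key
  · intro u v huv
    rcases eq_or_ne u (vtx 17) with rfl | hu
    · rw [Function.update_self, Function.update_of_ne huv.ne']
      exact hnbr v huv
    · rcases eq_or_ne v (vtx 17) with rfl | hv
      · rw [Function.update_self, Function.update_of_ne hu]
        exact (hnbr u huv.symm).symm
      · rw [Function.update_of_ne hu, Function.update_of_ne hv]
        exact hproper u v huv
  · intro v
    rcases eq_or_ne v (vtx 17) with rfl | hv
    · rwa [Function.update_self]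
    · rw [Function.update_of_ne hv]
      exact hcol v

/- Statement 8 -/
theorem stmt8 (φ : Fin 23 → ℕ) (hproper : ∀ u v, Mp.Adj u v → φ u ≠ φ v)
    (hcol : ∀ v, φ v ∈ ({1,2,3,4} : Set ℕ)) :
    φ (vtx 17) = φ (vtx 23) ∧
    ({φ (vtx 2), φ (vtx 4), φ (vtx 11), φ (vtx 17)} : Set ℕ) = {1,2,3,4} ∧
    ({φ (vtx 2), φ (vtx 4), φ (vtx 11), φ (vtx 23)} : Set ℕ) = {1,2,3,4} := by
  have hcol' : ∀ v, 1 ≤ φ v ∧ φ v ≤ 4 := by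
    intro v
    rcases hcol v with h | h | h | h <;> rw [h] <;> norm_num
  have heq := Mp_coloring_eq φ hproper hcol'
  have hset : ({φ (vtx 2), φ (vtx 4), φ (vtx 11), φ (vtx 23)} : Set ℕ) = {1,2,3,4} := by
    apply Set.Subset.antisymm
    · rintro _ (rfl | rfl | rfl | rfl) <;> exact hcol _
    · rintro c hc
      exact Mp_coloring_mem φ hproper hcol'
        (by rcases hc with rfl | rfl | rfl | rfl <;> norm_num)
  exact ⟨heq, heq ▸ hset, hset⟩
end

section
/- Every induced path in M' both of whose endvertices lie in T = {2, 4, 11, 23} contains at most 7 vertices. -/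
open SimpleGraph

/-- Exhaustive search for induced paths in the graph with neighbour lists `nbrs`. The current path
ends at `v`, and `forb` lists the earlier vertices of the path and their neighbours. The result is
`true` if no path reached by `k` further steps ends in a vertex satisfying `t` or can be extended. -/
def noLongPath {V : Type*} [DecidableEq V] (nbrs : V → List V) (t : V → Bool) :
    ℕ → V → List V → Bool
  | 0, v, forb => !t v && (nbrs v).all fun w => forb.contains w
  | k + 1, v, forb => (nbrs v).all fun w =>
      forb.contains w || noLongPath nbrs t k w (v :: nbrs v ++ forb)

theorem length_le_of_noLongPath {V : Type*} [DecidableEq V] {G : SimpleGraph V}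
    {nbrs : V → List V} (hn : ∀ u w, w ∈ nbrs u ↔ G.Adj u w) {t : V → Bool} {r : ℕ}
    (f : pathGraph r ↪g G) (k i : ℕ) (hi : i < r) (ht : t (f ⟨r - 1, by omega⟩) = true)
    (forb : List V) (hf : ∀ w ∈ forb, ∃ j : Fin r, j.val < i ∧ (w = f j ∨ G.Adj (f j) w))
    (h : noLongPath nbrs t k (f ⟨i, hi⟩) forb = true) : r ≤ i + k := by
  have step (i : ℕ) (hi : i + 1 < r) (forb : List V)
      (hf : ∀ w ∈ forb, ∃ j : Fin r, j.val < i ∧ (w = f j ∨ G.Adj (f j) w)) :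
      f ⟨i + 1, hi⟩ ∈ nbrs (f ⟨i, by omega⟩) ∧ f ⟨i + 1, hi⟩ ∉ forb := by
    refine ⟨(hn _ _).2 (f.map_adj_iff.2 (by simp [pathGraph_adj])), fun hw => ?_⟩
    obtain ⟨j, hj, he | ha⟩ := hf _ hw
    · have := congrArg Fin.val (f.injective he)
      simp only at this
      omega
    · rw [f.map_adj_iff, pathGraph_adj] at ha
      simp only at ha
      omega
  induction k generalizing i forb with
  | zero =>
    simp only [noLongPath, Bool.and_eq_true, List.all_eq_true, List.contains_iff_mem] at h
    by_contra! hlt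
    by_cases hr : i + 1 < r
    · exact (step i hr forb hf).2 (h.2 _ (step i hr forb hf).1)
    · have hi' : i = r - 1 := by omega
      subst hi'
      simp [ht] at h
  | succ k ih =>
    simp only [noLongPath, List.all_eq_true, Bool.or_eq_true, List.contains_iff_mem] at h
    by_cases hr : i + 1 < r
    · have hf' : ∀ w ∈ f ⟨i, hi⟩ :: nbrs (f ⟨i, hi⟩) ++ forb,
          ∃ j : Fin r, j.val < i + 1 ∧ (w = f j ∨ G.Adj (f j) w) := by
        intro w hw
        simp only [List.cons_append, List.mem_cons, List.mem_append] at hw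
        rcases hw with rfl | hw | hw
        · exact ⟨⟨i, hi⟩, by simp, .inl rfl⟩
        · exact ⟨⟨i, hi⟩, by simp, .inr ((hn _ _).1 hw)⟩
        · obtain ⟨j, hj, hw⟩ := hf w hw
          exact ⟨j, by omega, hw⟩
      have hle : r ≤ i + 1 + k := ih (i + 1) hr ht _ hf'
        ((h _ (step i hr forb hf).1).resolve_left (step i hr forb hf).2) step
      omega
    · omega

/-- The list of neighbours of a vertex of `M'`. -/
def MpNbrs (u : Fin 23) : List (Fin 23) :=
  MpEdges.filterMap fun e =>
    if vtx e.1 = u then some (vtx e.2) else if vtx e.2 = u then some (vtx e.1) else none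

instance inst_s9 : DecidableRel Mp.Adj := fun u v =>
  inferInstanceAs (Decidable (u ≠ v ∧ ((∃ e ∈ MpEdges, u = vtx e.1 ∧ v = vtx e.2) ∨
    ∃ e ∈ MpEdges, v = vtx e.1 ∧ u = vtx e.2)))

theorem mem_MpNbrs_iff : ∀ u w, w ∈ MpNbrs u ↔ Mp.Adj u w := by
  decide +kernel

instance : DecidablePred (· ∈ Tset) := fun v =>
  inferInstanceAs (Decidable (v = vtx 2 ∨ v = vtx 4 ∨ v = vtx 11 ∨ v = vtx 23))

theorem noLongPath_MpNbrs :
    ∀ v, v ∈ Tset → noLongPath MpNbrs (fun w => decide (w ∈ Tset)) 7 v [] = true := by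
  decide +kernel

/- Statement 9 -/
theorem stmt9 (r : ℕ) (hr : 1 ≤ r) (f : pathGraph r ↪g Mp)
    (h0 : f ⟨0, by omega⟩ ∈ Tset) (h1 : f ⟨r - 1, by omega⟩ ∈ Tset) : r ≤ 7 := by
  simpa using length_le_of_noLongPath mem_MpNbrs_iff f 7 0 hr (by simpa using h1) [] (by simp)
    (noLongPath_MpNbrs _ h0)
end

section
/- Every induced path in M' with at least one endvertex in T = {2, 4, 11, 23} contains at most 8 vertices. -/
open SimpleGraph

/-- A search certifying that every path `v, p₁, p₂, …` with all `pᵢ` in `A`, consecutive vertices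
related by `adj` and non-consecutive ones (in increasing order) not, has at most `k` vertices. -/
def inducedPathBound {V : Type*} (adj : V → V → Bool) : ℕ → V → List V → Bool
  | 0, _, _ => false
  | k + 1, v, A =>
      (A.filter (adj v)).all fun w => inducedPathBound adj k w (A.filter fun u => !adj v u)

theorem length_le_of_inducedPathBound {V : Type*} {adj : V → V → Bool} {k : ℕ} {A : List V}
    {p : ℕ → V} {n : ℕ} (hb : inducedPathBound adj k (p 0) A = true)
    (hA : ∀ i, 0 < i → i < n → p i ∈ A)
    (hp : ∀ i j, i < j → j < n → (adj (p i) (p j) = true ↔ i + 1 = j)) : n ≤ k := by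
  induction k generalizing A p n with
  | zero => simp [inducedPathBound] at hb
  | succ k ih =>
    by_cases hn : n ≤ 1
    · omega
    · simp only [inducedPathBound, List.all_eq_true, List.mem_filter] at hb
      have hstep := hb (p 1) ⟨hA 1 one_pos (by omega), (hp 0 1 one_pos (by omega)).2 rfl⟩
      have hle : n - 1 ≤ k := by
        refine ih (p := fun i => p (i + 1)) hstep (fun i hi hin => ?_) fun i j hij hjn => ?_
        · have hnot := hp 0 (i + 1) (by omega) (by omega)
          refine List.mem_filter.2 ⟨hA _ (by omega) (by omega), ?_⟩
          simp only [Bool.not_eq_true', Bool.eq_false_iff, ne_eq, hnot]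
          omega
        · simpa using hp (i + 1) (j + 1) (by omega) (by omega)
      omega

/-- The neighbourhoods (by labels) of the vertices of `Mp`. -/
def MpNeighbors : List (List ℕ) :=
  [[2, 4, 7, 9, 13, 15, 18, 20], [1, 3, 6, 8, 12, 14, 17, 19], [2, 5, 7, 10, 13, 16, 18, 21],
   [1, 5, 6, 10, 12, 16, 17, 21],
   [3, 4, 8, 9, 14, 15, 19, 20], [2, 4, 11, 13, 15, 22], [1, 3, 11, 12, 14, 22], [2, 5, 11, 13, 16, 22],
   [1, 5, 11, 12, 16, 22], [3, 4, 11, 14, 15, 22], [6, 7, 8, 9, 10, 17, 18, 19, 20, 21], [2, 4, 7, 9, 23],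
   [1, 3, 6, 8, 23], [2, 5, 7, 10, 23], [1, 5, 6, 10, 23], [3, 4, 8, 9, 23],
   [2, 4, 11], [1, 3, 11, 23], [2, 5, 11, 23], [1, 5, 11, 23],
   [3, 4, 11, 23], [6, 7, 8, 9, 10, 23], [12, 13, 14, 15, 16, 18, 19, 20, 21, 22]]

/-- Boolean adjacency of `Mp`. -/
def MpAdj (u v : Fin 23) : Bool := (MpNeighbors.getD u []).contains (v.val + 1)

theorem Mp_adj_iff (u v : Fin 23) : Mp.Adj u v ↔ MpAdj u v = true := by
  simp only [Mp, fromRel_adj]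
  revert u v
  decide +kernel

theorem inducedPathBound_Mp {v : Fin 23} (hv : v ∈ Tset) :
    inducedPathBound MpAdj 8 v ((List.finRange 23).filter (· ≠ v)) = true := by
  simp only [Tset, Set.mem_insert_iff, Set.mem_singleton_iff] at hv
  rcases hv with rfl | rfl | rfl | rfl <;> decide +kernel

/-- An induced path of `Mp` with first vertex in `Tset` has at most eight vertices. -/
theorem pathGraph_le_eight_of_zero_mem {r : ℕ} (f : pathGraph (r + 1) ↪g Mp) (h : f 0 ∈ Tset) :
    r + 1 ≤ 8 := by
  refine length_le_of_inducedPathBound (p := fun i => f (Fin.ofNat (r + 1) i))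
    (inducedPathBound_Mp h) (fun i hi hin => ?_) fun i j hij hj => ?_
  · have hne : Fin.ofNat (r + 1) i ≠ 0 := by
      simp only [ne_eq, Fin.ext_iff, Fin.val_ofNat, Nat.mod_eq_of_lt hin, Fin.val_zero]
      omega
    exact List.mem_filter.2 ⟨List.mem_finRange _, decide_eq_true (f.injective.ne hne)⟩
  · rw [← Mp_adj_iff, f.map_adj_iff, pathGraph_adj]
    simp only [Fin.val_ofNat, Nat.mod_eq_of_lt hj, Nat.mod_eq_of_lt (hij.trans hj)]
    omega

/-- The automorphism of a path reversing it. -/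
def pathGraphRev (r : ℕ) : pathGraph r ≃g pathGraph r where
  toEquiv := Fin.revPerm
  map_rel_iff' := by
    intro a b
    simp only [pathGraph_adj, Fin.revPerm_apply, Fin.val_rev]
    omega

/- Statement 10 -/
theorem stmt10 (r : ℕ) (hr : 1 ≤ r) (f : pathGraph r ↪g Mp)
    (h : f ⟨0, by omega⟩ ∈ Tset ∨ f ⟨r - 1, by omega⟩ ∈ Tset) : r ≤ 8 := by
  obtain ⟨r, rfl⟩ := Nat.exists_eq_succ_of_ne_zero (by omega : r ≠ 0)
  rcases h with h | h
  · exact pathGraph_le_eight_of_zero_mem f h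
  · refine pathGraph_le_eight_of_zero_mem (f.comp (pathGraphRev (r + 1)).toEmbedding) ?_
    have hrev : (f.comp (pathGraphRev (r + 1)).toEmbedding) 0 = f ⟨r.succ - 1, by omega⟩ :=
      congrArg f (Fin.rev_zero r)
    rwa [hrev]
end

section
/- M' contains no induced subgraph isomorphic to 2P_7 (the disjoint union of two 7-vertex paths) such that each of the two paths has an endvertex in T = {2, 4, 11, 23}. -/
open SimpleGraph

/-- The adjacency matrix of `Mp` as a bitmask: bit `23 * u + v` is set exactly when `u` and `v` are
adjacent. -/
def MpAdjBits : ℕ :=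
  864535560095984800232379031605635743335814506361924225860150391177418199804804651619080254510041923088308789204498410545484685832470439929956566232542424486218

/-- Adjacency in `Mp`, computed on the values of the vertices. -/
def MpTestAdj (u v : ℕ) : Bool := MpAdjBits.testBit (23 * u + v)

theorem Mp_adj_iff_testAdj (u v : Fin 23) : Mp.Adj u v ↔ MpTestAdj u v = true := by
  have adj_of_testAdj : ∀ u v : Fin 23, MpTestAdj u v = true → u ≠ v ∧
      ((∃ e ∈ MpEdges, u = vtx e.1 ∧ v = vtx e.2) ∨
        ∃ e ∈ MpEdges, v = vtx e.1 ∧ u = vtx e.2) := by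
    decide +kernel
  have testAdj_of_edge : ∀ e ∈ MpEdges, MpTestAdj (vtx e.1) (vtx e.2) = true ∧
      MpTestAdj (vtx e.2) (vtx e.1) = true := by
    decide +kernel
  refine ⟨?_, adj_of_testAdj u v⟩
  rintro ⟨-, ⟨e, he, rfl, rfl⟩ | ⟨e, he, rfl, rfl⟩⟩
  · exact (testAdj_of_edge e he).1
  · exact (testAdj_of_edge e he).2

/-- The number of vertices of `Mp` outside the closed neighbourhood of the vertices in `l`. -/
def MpUndominatedCount (l : List ℕ) : ℕ :=
  Nat.count (fun v => (l.all fun u => !(u == v || MpTestAdj u v)) = true) 23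

theorem MpUndominatedCount_lt_of_walk {a b c d e : Fin 23} (ha : a ∈ Tset)
    (hab : Mp.Adj a b) (hbc : Mp.Adj b c) (hac : a ≠ c) (hcd : Mp.Adj c d) (hbd : b ≠ d)
    (hde : Mp.Adj d e) (hce : c ≠ e) :
    MpUndominatedCount [a, b, c, d] < 7 ∨ MpUndominatedCount [a, b, c, d, e] < 7 := by
  have key : ([1, 3, 10, 22].all fun a =>
      (List.range 23).all fun b => !MpTestAdj a b ||
      (List.range 23).all fun c => !MpTestAdj b c || a == c ||
      (List.range 23).all fun d => !MpTestAdj c d || b == d ||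
        (MpUndominatedCount [a, b, c, d]).blt 7 ||
      (List.range 23).all fun e => !MpTestAdj d e || c == e ||
        (MpUndominatedCount [a, b, c, d, e]).blt 7) = true := by
    decide +kernel
  have ha' : a.val ∈ [1, 3, 10, 22] := by
    rcases ha with rfl | rfl | rfl | rfl <;> decide
  rw [Mp_adj_iff_testAdj] at hab hbc hcd hde
  rw [← Fin.val_ne_iff, ← beq_eq_false_iff_ne] at hac hbd hce
  have mem (v : Fin 23) : v.val ∈ List.range 23 := List.mem_range.mpr v.isLt
  have h := List.all_eq_true.mp key _ ha'
  replace h := List.all_eq_true.mp h _ (mem b)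
  rw [hab, Bool.not_true, Bool.false_or] at h
  replace h := List.all_eq_true.mp h _ (mem c)
  rw [hbc, hac, Bool.not_true, Bool.false_or, Bool.false_or] at h
  replace h := List.all_eq_true.mp h _ (mem d)
  rw [hcd, hbd, Bool.not_true, Bool.false_or, Bool.false_or, Bool.or_eq_true] at h
  refine h.imp Nat.blt_eq.mp fun h => ?_
  replace h := List.all_eq_true.mp h _ (mem e)
  rw [hde, hce, Bool.not_true, Bool.false_or, Bool.false_or] at h
  exact Nat.blt_eq.mp h

/- Statement 12 -/
theorem stmt12 :
    ¬ ∃ (f g : pathGraph 7 ↪g Mp),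
        (f (0 : Fin 7) ∈ Tset ∨ f (6 : Fin 7) ∈ Tset) ∧
        (g (0 : Fin 7) ∈ Tset ∨ g (6 : Fin 7) ∈ Tset) ∧
        (∀ i j, f i ≠ g j) ∧ (∀ i j, ¬ Mp.Adj (f i) (g j)) := by
  rintro ⟨f, g, hf, -, hne, hadj⟩
  have count_ge (l : List (Fin 7)) : 7 ≤ MpUndominatedCount (l.map fun i => (f i).val) := by
    rw [MpUndominatedCount, Nat.count_eq_card_filter_range]
    refine (Finset.card_fin 7).symm.trans_le <| Finset.card_le_card_of_injOn (fun j => (g j).val)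
      (fun j _ => ?_) (Fin.val_injective.comp g.injective).injOn
    have hval (i : Fin 7) : (f i).val ≠ (g j).val := Fin.val_injective.ne (hne i j)
    have htest (i : Fin 7) : MpTestAdj (f i) (g j) = false := by
      simpa [Mp_adj_iff_testAdj] using hadj i j
    simp [hval, htest]
  have adj (i j : Fin 7) (h : i.val + 1 = j.val ∨ j.val + 1 = i.val) : Mp.Adj (f i) (f j) :=
    f.map_rel_iff.mpr (pathGraph_adj.mpr h)
  have no_walk (i j k l m : Fin 7) (hi : f i ∈ Tset) (hij : i.val + 1 = j.val ∨ j.val + 1 = i.val)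
      (hjk : j.val + 1 = k.val ∨ k.val + 1 = j.val) (hik : i ≠ k)
      (hkl : k.val + 1 = l.val ∨ l.val + 1 = k.val) (hjl : j ≠ l)
      (hlm : l.val + 1 = m.val ∨ m.val + 1 = l.val) (hkm : k ≠ m) : False :=
    (MpUndominatedCount_lt_of_walk hi (adj _ _ hij) (adj _ _ hjk) (f.injective.ne hik)
      (adj _ _ hkl) (f.injective.ne hjl) (adj _ _ hlm) (f.injective.ne hkm)).elim
      (count_ge [i, j, k, l]).not_gt (count_ge [i, j, k, l, m]).not_gt
  rcases hf with h | h
  · exact no_walk 0 1 2 3 4 h (by decide) (by decide) (by decide) (by decide) (by decide)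
      (by decide) (by decide)
  · exact no_walk 6 5 4 3 2 h (by decide) (by decide) (by decide) (by decide) (by decide)
      (by decide) (by decide)
end
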